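/- Assume that all functions in N^{1,p}(X) are quasicontinuous, and let A ⊂ E with dist(A, X \ E) > 0. Then cap_p(A,E) = inf { cap_p(G,E) : G open, A ⊂ G ⊂ E }. (This holds for all 1 ≤ p < ∞, in particular for p = 1.) -/

import Mathlib

open MeasureTheory Metric Set Filter
open scoped ENNReal NNReal Topology

noncomputable section

variable {X : Type*} [MetricSpace X] [MeasurableSpace X] [BorelSpace X]

/-- A nonconstant, compact, rectifiable curve in `X`, parameterized by arc length on
`[0, len]`. The arc-length parameterization is expressed by requiring that the length
(total variation) of the curve on each subinterval `[s, t]` equals `t - s`. -/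
structure Curve (X : Type*) [MetricSpace X] where
  len : ℝ
  len_pos : 0 < len
  toFun : ℝ → X
  continuousOn : ContinuousOn toFun (Set.Icc 0 len)
  arclength : ∀ s t : ℝ, s ∈ Set.Icc 0 len → t ∈ Set.Icc 0 len → s ≤ t →
    eVariationOn toFun (Set.Icc s t) = ENNReal.ofReal (t - s)
  nonconstant : ∃ s ∈ Set.Icc 0 len, ∃ t ∈ Set.Icc 0 len, toFun s ≠ toFun t

/-- The curve integral `∫_γ g ds` of a nonnegative function along an arc-length
parameterized curve. -/
def Curve.integral (γ : Curve X) (g : X → ℝ≥0∞) : ℝ≥0∞ :=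
  ∫⁻ t in Set.Icc (0 : ℝ) γ.len, g (γ.toFun t)

/-- `|a - b|` with the convention that it is `∞` whenever both `a` and `b` are infinite. -/
def ugDiff (a b : EReal) : ℝ≥0∞ :=
  if a.abs = ⊤ ∨ b.abs = ⊤ then ⊤ else (a - b).abs

/-- The upper gradient inequality for `f` and `g` along the curve `γ`. -/
def UGOn (f : X → EReal) (g : X → ℝ≥0∞) (γ : Curve X) : Prop :=
  ugDiff (f (γ.toFun 0)) (f (γ.toFun γ.len)) ≤ γ.integral g

/-- A curve family has zero `p`-modulus. -/
def ZeroModulus (p : ℝ) (μ : Measure X) (Γ : Set (Curve X)) : Prop :=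
  ∃ ρ : X → ℝ≥0∞, Measurable ρ ∧ (∫⁻ x, ρ x ^ p ∂μ) < ⊤ ∧ ∀ γ ∈ Γ, γ.integral ρ = ⊤

/-- `g` is an upper gradient of `f`. -/
def IsUpperGradient (f : X → EReal) (g : X → ℝ≥0∞) : Prop :=
  Measurable g ∧ ∀ γ : Curve X, UGOn f g γ

/-- `g` is a `p`-weak upper gradient of `f`: the upper gradient inequality holds for
`p`-almost every curve. -/
def IsWeakUpperGradient (p : ℝ) (μ : Measure X) (f : X → EReal) (g : X → ℝ≥0∞) : Prop :=
  Measurable g ∧ ZeroModulus p μ {γ : Curve X | ¬ UGOn f g γ}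

/-- The energy `∫_X g_u^p dμ` of the minimal `p`-weak upper gradient of `u`, expressed as
the infimum of `∫_X g^p dμ` over all `p`-weak upper gradients `g` of `u`
(`= ∞` if `u` has no `p`-weak upper gradient). -/
def gradEnergy (p : ℝ) (μ : Measure X) (u : X → EReal) : ℝ≥0∞ :=
  ⨅ (g : X → ℝ≥0∞) (_ : IsWeakUpperGradient p μ u g), ∫⁻ x, g x ^ p ∂μ

/-- The Newtonian energy `‖u‖_{N^{1,p}(X)}^p = ∫_X |u|^p dμ + ∫_X g_u^p dμ`. -/
def newtonianEnergy (p : ℝ) (μ : Measure X) (u : X → EReal) : ℝ≥0∞ :=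
  (∫⁻ x, (u x).abs ^ p ∂μ) + gradEnergy p μ u

/-- Membership in the Newtonian space `N^{1,p}(X)` (measurability is with respect to the
completion of the Borel σ-algebra, i.e. a.e.-measurability). -/
def MemNewtonian (p : ℝ) (μ : Measure X) (u : X → EReal) : Prop :=
  AEMeasurable u μ ∧ newtonianEnergy p μ u < ⊤

/-- Membership in `N^{1,p}_0(E)`, members being regarded as functions on all of `X`
that vanish outside `E`. -/
def MemNewtonian0 (p : ℝ) (μ : Measure X) (E : Set X) (u : X → EReal) : Prop :=
  MemNewtonian p μ u ∧ ∀ x ∉ E, u x = 0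

/-- The Sobolev capacity `C_p(A)`. -/
def sobolevCapacity (p : ℝ) (μ : Measure X) (A : Set X) : ℝ≥0∞ :=
  ⨅ (u : X → EReal) (_ : MemNewtonian p μ u ∧ ∀ x ∈ A, u x = 1), newtonianEnergy p μ u

/-- The variational capacity `cap_p(A, E)`. -/
def varCapacity (p : ℝ) (μ : Measure X) (A E : Set X) : ℝ≥0∞ :=
  ⨅ (u : X → EReal) (_ : MemNewtonian0 p μ E u ∧ ∀ x ∈ A, 1 ≤ u x), gradEnergy p μ u

/-- A function is quasicontinuous if outside open sets of arbitrarily small Sobolev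
capacity it is real-valued and continuous. -/
def QuasicontinuousFun (p : ℝ) (μ : Measure X) (u : X → EReal) : Prop :=
  ∀ ε : ℝ≥0∞, 0 < ε → ∃ G : Set X, IsOpen G ∧ sobolevCapacity p μ G < ε ∧
    (∀ x ∈ Gᶜ, u x ≠ ⊤ ∧ u x ≠ ⊥) ∧ ContinuousOn u Gᶜ

/-- The capacity `~cap_p(A,E)`: the infimum of `cap_p(G,E)` over all relatively open
subsets `G` of `E` containing `A`. -/
def varCapacityT (p : ℝ) (μ : Measure X) (A E : Set X) : ℝ≥0∞ :=
  ⨅ (G : Set X) (_ : A ⊆ G ∧ G ⊆ E ∧ ∃ U : Set X, IsOpen U ∧ G = U ∩ E),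
    varCapacity p μ G E


set_option linter.unusedSectionVars false

/-- A product rule for upper gradients along an interval: if `G` controls the oscillation of `φ`
and `W` dominates `φ`, then `G + L * W` controls the oscillation of the product of `φ` with an
`L`-Lipschitz function `η`. -/
lemma ofReal_abs_mul_sub_mul_le_lintegral {φ η : ℝ → ℝ} {G W : ℝ → ℝ≥0∞} {l : ℝ} {L : ℝ≥0}
    (hl : 0 < l)
    (hG : ∀ s t, 0 ≤ s → s < t → t ≤ l →
      ENNReal.ofReal |φ s - φ t| ≤ ∫⁻ r in Icc s t, G r)
    (hφ : ∀ t, 0 ≤ φ t) (hη0 : ∀ t, 0 ≤ η t) (hη1 : ∀ t, η t ≤ 1)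
    (hηL : ∀ s t, 0 ≤ s → s < t → t ≤ l → |η s - η t| ≤ L * (t - s))
    (hW : ∀ t, ENNReal.ofReal (φ t) ≤ W t) :
    ENNReal.ofReal |η 0 * φ 0 - η l * φ l| ≤ ∫⁻ r in Icc 0 l, (G r + L * W r) := by
  have hG' : ∀ s t, 0 ≤ s → s < t → t ≤ l →
      ENNReal.ofReal |φ s - φ t| ≤ ∫⁻ r in Ioc s t, G r := by
    intro s t hs hst ht
    rw [restrict_Ioc_eq_restrict_Icc]
    exact hG s t hs hst ht
  have step : ∀ s t, 0 ≤ s → s < t → t ≤ l →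
      ENNReal.ofReal |η s * φ s - η t * φ t| ≤
        (1 + L * ENNReal.ofReal (t - s)) * (∫⁻ r in Ioc s t, G r)
          + L * ∫⁻ r in Ioc s t, W r := by
    intro s t hs hst ht
    have hts : 0 ≤ t - s := by linarith
    have h1 : |η s * φ s - η t * φ t| ≤ |φ s - φ t| + L * ((t - s) * φ t) := by
      have : η s * φ s - η t * φ t = η s * (φ s - φ t) + (η s - η t) * φ t := by ring
      rw [this]
      refine (abs_add_le _ _).trans (add_le_add ?_ ?_)
      · rw [abs_mul, abs_of_nonneg (hη0 s)]
        exact mul_le_of_le_one_left (abs_nonneg _) (hη1 s)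
      · rw [abs_mul, abs_of_nonneg (hφ t), ← mul_assoc]
        exact mul_le_mul_of_nonneg_right (hηL s t hs hst ht) (hφ t)
    have h2 : ENNReal.ofReal (t - s) * ENNReal.ofReal (φ t) ≤
        (∫⁻ r in Ioc s t, W r) + ENNReal.ofReal (t - s) * ∫⁻ r in Ioc s t, G r := by
      calc ENNReal.ofReal (t - s) * ENNReal.ofReal (φ t)
          = ∫⁻ _ in Ioc s t, ENNReal.ofReal (φ t) := by
            rw [setLIntegral_const, Real.volume_Ioc, mul_comm]
        _ ≤ ∫⁻ r in Ioc s t, (W r + ∫⁻ r in Ioc s t, G r) := by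
            refine setLIntegral_mono' measurableSet_Ioc fun r hr => ?_
            rcases eq_or_lt_of_le hr.2 with h | h
            · rw [h]
              exact (hW t).trans le_self_add
            · have h3 : φ t ≤ φ r + |φ r - φ t| := by
                have := neg_abs_le (φ r - φ t)
                linarith
              refine (ENNReal.ofReal_le_ofReal h3).trans ?_
              rw [ENNReal.ofReal_add (hφ r) (abs_nonneg _)]
              refine add_le_add (hW r) ((hG' r t (hs.trans hr.1.le) h ht).trans ?_)
              exact lintegral_mono_set (Ioc_subset_Ioc_left hr.1.le)
        _ = _ := by
            rw [lintegral_add_right _ measurable_const, setLIntegral_const, Real.volume_Ioc,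
              mul_comm (ENNReal.ofReal _)]
    refine (ENNReal.ofReal_le_ofReal h1).trans ?_
    rw [ENNReal.ofReal_add (abs_nonneg _) (by have := hφ t; positivity),
      ENNReal.ofReal_mul L.coe_nonneg, ENNReal.ofReal_mul hts, ENNReal.ofReal_coe_nnreal]
    refine (add_le_add (hG' s t hs hst ht) (mul_le_mul_right h2 _)).trans (le_of_eq ?_)
    ring
  set a := ∫⁻ r in Ioc 0 l, G r
  set b := ∫⁻ r in Ioc 0 l, W r with hb
  have key : ∀ n : ℕ, 0 < n → ENNReal.ofReal |η 0 * φ 0 - η l * φ l| ≤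
      (1 + L * ENNReal.ofReal (l / n)) * a + L * b := by
    intro n hn
    have hn' : (0 : ℝ) < n := by exact_mod_cast hn
    have hδ : 0 < l / n := by positivity
    have ind : ∀ i : ℕ, i ≤ n →
        ENNReal.ofReal |η 0 * φ 0 - η (i * (l / n)) * φ (i * (l / n))| ≤
          (1 + L * ENNReal.ofReal (l / n)) * (∫⁻ r in Ioc 0 (i * (l / n)), G r)
            + L * ∫⁻ r in Ioc 0 (i * (l / n)), W r := by
      intro i
      induction i with
      | zero => simp
      | succ i ih =>
        intro hi
        have hs : (0 : ℝ) ≤ i * (l / n) := by positivity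
        have hst : (i : ℝ) * (l / n) < (i + 1 : ℕ) * (l / n) := by
          push_cast
          nlinarith
        have ht : ((i + 1 : ℕ) : ℝ) * (l / n) ≤ l := by
          have : ((i + 1 : ℕ) : ℝ) ≤ n := by exact_mod_cast hi
          calc ((i + 1 : ℕ) : ℝ) * (l / n) ≤ n * (l / n) := by gcongr
            _ = l := by field_simp
        have hd : ((i + 1 : ℕ) : ℝ) * (l / n) - i * (l / n) = l / n := by
          push_cast
          ring
        have h1 := ih (by omega)
        have h2 := step _ _ hs hst ht
        rw [hd] at h2
        have hsplit : ∀ F : ℝ → ℝ≥0∞, ∫⁻ r in Ioc 0 (((i + 1 : ℕ) : ℝ) * (l / n)), F r =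
            (∫⁻ r in Ioc 0 ((i : ℝ) * (l / n)), F r) +
              ∫⁻ r in Ioc ((i : ℝ) * (l / n)) (((i + 1 : ℕ) : ℝ) * (l / n)), F r := by
          intro F
          rw [← Ioc_union_Ioc_eq_Ioc hs hst.le]
          exact lintegral_union measurableSet_Ioc (Ioc_disjoint_Ioc_of_le le_rfl)
        rw [hsplit G, hsplit W]
        refine (ENNReal.ofReal_le_ofReal (abs_sub_le _
          (η (i * (l / n)) * φ (i * (l / n))) _)).trans ?_
        rw [ENNReal.ofReal_add (abs_nonneg _) (abs_nonneg _)]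
        refine (add_le_add h1 h2).trans (le_of_eq ?_)
        ring
    have h := ind n le_rfl
    have hnl : (n : ℝ) * (l / n) = l := by field_simp
    rwa [hnl] at h
  have hsum : a + L * b ≤ ∫⁻ r in Icc 0 l, (G r + L * W r) := by
    rw [← restrict_Ioc_eq_restrict_Icc, hb, ← lintegral_const_mul' _ _ ENNReal.coe_ne_top]
    exact le_lintegral_add _ _
  refine le_trans ?_ hsum
  by_cases hatop : a = ⊤
  · simp [hatop]
  have hlim : Tendsto (fun n : ℕ => (1 + L * ENNReal.ofReal (l / n)) * a + L * b) atTop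
      (𝓝 ((1 + L * ENNReal.ofReal 0) * a + L * b)) := by
    have h0 : Tendsto (fun n : ℕ => ENNReal.ofReal (l / n)) atTop (𝓝 (ENNReal.ofReal 0)) :=
      ENNReal.tendsto_ofReal (tendsto_const_div_atTop_nhds_zero_nat l)
    refine Tendsto.add ?_ tendsto_const_nhds
    refine ENNReal.Tendsto.mul_const ?_ (Or.inr hatop)
    refine tendsto_const_nhds.add ?_
    exact ENNReal.Tendsto.const_mul h0 (Or.inr ENNReal.coe_ne_top)
  have := ge_of_tendsto hlim (eventually_atTop.2 ⟨1, fun n hn => key n hn⟩)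
  simpa using this

lemma Curve.dist_le (γ : Curve X) {s t : ℝ} (hs : 0 ≤ s) (hst : s ≤ t) (ht : t ≤ γ.len) :
    dist (γ.toFun s) (γ.toFun t) ≤ t - s := by
  have h := eVariationOn.edist_le γ.toFun (left_mem_Icc.2 hst) (right_mem_Icc.2 hst)
  rw [γ.arclength s t ⟨hs, hst.trans ht⟩ ⟨hs.trans hst, ht⟩ hst, edist_dist] at h
  exact (ENNReal.ofReal_le_ofReal_iff (by linarith)).1 h

/-- The restriction of a curve to a nondegenerate subinterval. -/
def Curve.restrict (γ : Curve X) (s t : ℝ) (hs : 0 ≤ s) (hst : s < t) (ht : t ≤ γ.len) :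
    Curve X where
  len := t - s
  len_pos := by linarith
  toFun := fun r => γ.toFun (r + s)
  continuousOn := γ.continuousOn.comp (by fun_prop) fun r hr =>
    ⟨by linarith [hr.1], by linarith [hr.2]⟩
  arclength := by
    intro a b ha hb hab
    have h := eVariationOn.comp_eq_of_monotoneOn γ.toFun (t := Icc a b) (fun r => r + s)
      (fun x _ y _ hxy => by simpa using hxy)
    rw [image_add_const_Icc] at h
    rw [show b - a = (b + s) - (a + s) by ring,
      ← γ.arclength (a + s) (b + s) ⟨by linarith [ha.1], by linarith [ha.2]⟩
        ⟨by linarith [hb.1], by linarith [hb.2]⟩ (by linarith), ← h]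
    rfl
  nonconstant := by
    by_contra! hcon
    have h := γ.arclength s t ⟨hs, hst.le.trans ht⟩ ⟨hs.trans hst.le, ht⟩ hst.le
    have h0 : eVariationOn γ.toFun (Icc s t) = 0 := by
      refine eVariationOn.constant_on ?_
      rintro _ ⟨x, hx, rfl⟩ _ ⟨y, hy, rfl⟩
      have := hcon (x - s) ⟨by linarith [hx.1], by linarith [hx.2]⟩
        (y - s) ⟨by linarith [hy.1], by linarith [hy.2]⟩
      simpa using this
    rw [h0] at h
    have := ENNReal.ofReal_pos.2 (sub_pos.2 hst)
    exact this.ne h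

lemma Curve.integral_restrict (γ : Curve X) {s t : ℝ} (hs : 0 ≤ s) (hst : s < t)
    (ht : t ≤ γ.len) (g : X → ℝ≥0∞) :
    (γ.restrict s t hs hst ht).integral g = ∫⁻ r in Icc s t, g (γ.toFun r) := by
  have h := (measurePreserving_add_right volume s).setLIntegral_comp_preimage_emb
    (measurableEmbedding_addRight s) (fun r => g (γ.toFun r)) (Icc s t)
  rw [preimage_add_const_Icc, sub_self] at h
  exact h

lemma ugDiff_coe (a b : ℝ) : ugDiff (a : EReal) (b : EReal) = ENNReal.ofReal |a - b| := by
  have h1 := (EReal.abs_coe_lt_top a).ne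
  have h2 := (EReal.abs_coe_lt_top b).ne
  simp only [ugDiff, h1, h2, or_self, if_false]
  rw [← EReal.coe_sub, EReal.abs_def]

/-- Truncation of an extended real to the unit interval. -/
def truncUnit (a : EReal) : ℝ := (max 0 (min 1 a)).toReal

lemma coe_truncUnit (a : EReal) : (truncUnit a : EReal) = max 0 (min 1 a) := by
  refine EReal.coe_toReal ?_ ?_
  · exact ((max_le zero_le_one (min_le_left _ _)).trans_lt (EReal.coe_lt_top 1)).ne
  · exact ((EReal.bot_lt_coe 0).trans_le (le_max_left _ _)).ne'

lemma truncUnit_nonneg (a : EReal) : 0 ≤ truncUnit a := by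
  rw [← EReal.coe_nonneg, coe_truncUnit]
  exact le_max_left _ _

lemma truncUnit_le_one (a : EReal) : truncUnit a ≤ 1 := by
  rw [← EReal.coe_le_coe_iff, coe_truncUnit]
  exact max_le zero_le_one (min_le_left _ _)

lemma truncUnit_zero : truncUnit 0 = 0 := by
  simp [truncUnit]

lemma truncUnit_of_one_le {a : EReal} (h : 1 ≤ a) : truncUnit a = 1 := by
  simp [truncUnit, h]

lemma truncUnit_coe (a : ℝ) : truncUnit (a : EReal) = max 0 (min 1 a) := by
  rw [← EReal.coe_eq_coe_iff, coe_truncUnit, EReal.coe_strictMono.monotone.map_max,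
    EReal.coe_strictMono.monotone.map_min, EReal.coe_zero, EReal.coe_one]

lemma measurable_truncUnit : Measurable truncUnit := by
  unfold truncUnit
  exact measurable_ereal_toReal.comp (by fun_prop)

lemma ugDiff_truncUnit_le (a b : EReal) :
    ugDiff (truncUnit a : EReal) (truncUnit b : EReal) ≤ ugDiff a b := by
  induction a with
  | bot => simp [ugDiff]
  | top => simp [ugDiff]
  | coe a =>
    induction b with
    | bot => simp [ugDiff]
    | top => simp [ugDiff]
    | coe b =>
      rw [ugDiff_coe, ugDiff_coe, truncUnit_coe, truncUnit_coe]
      refine ENNReal.ofReal_le_ofReal ?_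
      have h1 := abs_max_sub_max_le_max (0 : ℝ) (min 1 a) 0 (min 1 b)
      have h2 := abs_min_sub_min_le_max (1 : ℝ) a 1 b
      simp only [sub_self, abs_zero, abs_nonneg, max_eq_right] at h1 h2
      exact h1.trans h2

lemma abs_truncUnit_le (a : EReal) : (truncUnit a : EReal).abs ≤ a.abs := by
  induction a with
  | bot => simp
  | top => simp
  | coe a =>
    rw [truncUnit_coe, EReal.abs_def, EReal.abs_def]
    refine ENNReal.ofReal_le_ofReal ?_
    rw [abs_of_nonneg (le_max_left _ _)]
    exact max_le (abs_nonneg _) ((min_le_right _ _).trans (le_abs_self a))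

lemma ZeroModulus.mono {p : ℝ} {μ : Measure X} {Γ Γ' : Set (Curve X)} (h : ZeroModulus p μ Γ)
    (hs : Γ' ⊆ Γ) : ZeroModulus p μ Γ' := by
  obtain ⟨ρ, h1, h2, h3⟩ := h
  exact ⟨ρ, h1, h2, fun γ hγ => h3 γ (hs hγ)⟩

lemma Curve.integral_mono (γ : Curve X) {g h : X → ℝ≥0∞} (hgh : g ≤ h) :
    γ.integral g ≤ γ.integral h :=
  lintegral_mono fun _ => hgh _

lemma ZeroModulus.union {p : ℝ} {μ : Measure X} (hp : 1 ≤ p) {Γ Γ' : Set (Curve X)}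
    (h : ZeroModulus p μ Γ) (h' : ZeroModulus p μ Γ') : ZeroModulus p μ (Γ ∪ Γ') := by
  obtain ⟨ρ, h1, h2, h3⟩ := h
  obtain ⟨σ, k1, k2, k3⟩ := h'
  refine ⟨ρ + σ, h1.add k1,
    ENNReal.lintegral_rpow_add_lt_top_of_lintegral_rpow_lt_top h1.aemeasurable h2 k2 hp, ?_⟩
  rintro γ (hγ | hγ)
  · exact top_le_iff.1 ((h3 γ hγ).symm.le.trans (γ.integral_mono fun _ => le_self_add))
  · exact top_le_iff.1 ((k3 γ hγ).symm.le.trans (γ.integral_mono fun _ => le_add_self))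

/-- If almost no curve belongs to `Γ`, then almost no curve has a subcurve in `Γ`. -/
lemma ZeroModulus.of_subcurve {p : ℝ} {μ : Measure X} {Γ : Set (Curve X)}
    (h : ZeroModulus p μ Γ) :
    ZeroModulus p μ {γ : Curve X | ∃ (s t : ℝ) (hs : 0 ≤ s) (hst : s < t) (ht : t ≤ γ.len),
      γ.restrict s t hs hst ht ∈ Γ} := by
  obtain ⟨ρ, h1, h2, h3⟩ := h
  refine ⟨ρ, h1, h2, ?_⟩
  rintro γ ⟨s, t, hs, hst, ht, hγ⟩
  have h4 := h3 _ hγ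
  rw [γ.integral_restrict] at h4
  exact top_le_iff.1 (h4.symm.le.trans (lintegral_mono_set (Icc_subset_Icc hs ht)))

lemma IsWeakUpperGradient.truncUnit {p : ℝ} {μ : Measure X} {u : X → EReal} {g : X → ℝ≥0∞}
    (h : IsWeakUpperGradient p μ u g) :
    IsWeakUpperGradient p μ (fun x => (truncUnit (u x) : EReal)) g :=
  ⟨h.1, h.2.mono fun _ hγ hu => hγ ((ugDiff_truncUnit_le _ _).trans hu)⟩

lemma MemNewtonian.truncUnit {p : ℝ} {μ : Measure X} (hp : 1 ≤ p) {u : X → EReal}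
    (h : MemNewtonian p μ u) : MemNewtonian p μ (fun x => (truncUnit (u x) : EReal)) := by
  refine ⟨(measurable_coe_real_ereal.comp measurable_truncUnit).comp_aemeasurable h.1,
    lt_of_le_of_lt (add_le_add ?_ ?_) h.2⟩
  · exact lintegral_mono fun x =>
      ENNReal.rpow_le_rpow (abs_truncUnit_le _) (by linarith)
  · exact le_iInf₂ fun g hg => iInf₂_le g hg.truncUnit

/-- The product rule for weak upper gradients, with a Lipschitz cutoff function `η`. -/
lemma IsWeakUpperGradient.lipschitz_mul {p : ℝ} {μ : Measure X} {v η : X → ℝ}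
    {h w : X → ℝ≥0∞} {L : ℝ≥0} (hv : IsWeakUpperGradient p μ (fun x => (v x : EReal)) h)
    (hv0 : ∀ x, 0 ≤ v x) (hη0 : ∀ x, 0 ≤ η x) (hη1 : ∀ x, η x ≤ 1) (hη : LipschitzWith L η)
    (hw : Measurable w) (hvw : ∀ x, ENNReal.ofReal (v x) ≤ w x) :
    IsWeakUpperGradient p μ (fun x => ((η x * v x : ℝ) : EReal)) (fun x => h x + L * w x) := by
  refine ⟨hv.1.add (hw.const_mul _), hv.2.of_subcurve.mono ?_⟩
  intro γ hγ
  by_contra hcon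
  refine hγ ?_
  have hgood : ∀ s t, 0 ≤ s → s < t → t ≤ γ.len →
      ENNReal.ofReal |v (γ.toFun s) - v (γ.toFun t)| ≤ ∫⁻ r in Icc s t, h (γ.toFun r) := by
    intro s t hs hst ht
    by_contra hbad
    refine hcon ⟨s, t, hs, hst, ht, fun hug => hbad ?_⟩
    simp only [UGOn, γ.integral_restrict, ugDiff_coe] at hug
    simpa [Curve.restrict] using hug
  simp only [UGOn, ugDiff_coe]
  refine ofReal_abs_mul_sub_mul_le_lintegral (φ := fun r => v (γ.toFun r))
    (η := fun r => η (γ.toFun r)) γ.len_pos hgood (fun _ => hv0 _) (fun _ => hη0 _)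
    (fun _ => hη1 _) ?_ (fun _ => hvw _)
  intro s t hs hst ht
  rw [← Real.dist_eq]
  exact (hη.dist_le_mul _ _).trans
    (mul_le_mul_of_nonneg_left (γ.dist_le hs hst.le ht) L.coe_nonneg)

lemma IsWeakUpperGradient.max_const_mul {p : ℝ} {μ : Measure X} (hp : 1 ≤ p) {u v : X → ℝ}
    {g h : X → ℝ≥0∞} {c : ℝ} (hc : 0 ≤ c)
    (hu : IsWeakUpperGradient p μ (fun x => (u x : EReal)) g)
    (hv : IsWeakUpperGradient p μ (fun x => (v x : EReal)) h) :
    IsWeakUpperGradient p μ (fun x => ((max (c * u x) (v x) : ℝ) : EReal))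
      (fun x => ENNReal.ofReal c * g x + h x) := by
  refine ⟨(hu.1.const_mul _).add hv.1, (hu.2.union hp hv.2).mono ?_⟩
  intro γ hγ
  by_contra hcon
  simp only [mem_union, mem_ofPred_eq, not_or, not_not, UGOn, ugDiff_coe] at hcon
  refine hγ ?_
  simp only [UGOn, ugDiff_coe]
  have h1 : γ.integral (fun x => ENNReal.ofReal c * g x) = ENNReal.ofReal c * γ.integral g :=
    lintegral_const_mul' _ _ ENNReal.ofReal_ne_top
  have h2 : γ.integral (fun x => ENNReal.ofReal c * g x) + γ.integral h ≤
      γ.integral (fun x => ENNReal.ofReal c * g x + h x) := le_lintegral_add _ _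
  refine le_trans ?_ h2
  rw [h1]
  refine le_trans ?_ (add_le_add (mul_le_mul_right hcon.1 _) hcon.2)
  rw [← ENNReal.ofReal_mul hc, ← ENNReal.ofReal_add (by positivity) (abs_nonneg _)]
  refine ENNReal.ofReal_le_ofReal ((abs_max_sub_max_le_max _ _ _ _).trans ?_)
  rw [← mul_sub, abs_mul, abs_of_nonneg hc]
  exact max_le_add_of_nonneg (by positivity) (abs_nonneg _)

lemma exists_measurable_ge_ae_eq {μ : Measure X} {f : X → ℝ≥0∞} (hf : AEMeasurable f μ) :
    ∃ w : X → ℝ≥0∞, Measurable w ∧ f ≤ w ∧ w =ᵐ[μ] f := by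
  classical
  set N := toMeasurable μ {x | f x ≠ hf.mk f x}
  have hN : μ N = 0 := by
    rw [measure_toMeasurable]
    exact hf.ae_eq_mk
  refine ⟨N.piecewise (fun _ => ⊤) (hf.mk f),
    Measurable.piecewise (measurableSet_toMeasurable _ _) measurable_const hf.measurable_mk,
    fun x => ?_, ?_⟩
  · by_cases hx : x ∈ N
    · simp [hx]
    · have : f x = hf.mk f x := by
        by_contra h
        exact hx (subset_toMeasurable _ _ h)
      simp [hx, this]
  · have : ∀ᵐ x ∂μ, x ∉ N := measure_eq_zero_iff_ae_notMem.1 hN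
    filter_upwards [this, hf.ae_eq_mk] with x hx hx'
    simp [hx, hx']

lemma exists_weakUpperGradient_lt {p : ℝ} {μ : Measure X} {u : X → EReal} {δ : ℝ≥0∞}
    (h : gradEnergy p μ u < δ) :
    ∃ g, IsWeakUpperGradient p μ u g ∧ ∫⁻ x, g x ^ p ∂μ < δ := by
  simpa only [gradEnergy, iInf_lt_iff, exists_prop] using h

/-- A set of small Sobolev capacity carries a `[0, 1]`-valued test function whose weak upper
gradient and Borel majorant are both small in `L^p`. -/
lemma exists_test_of_sobolevCapacity_lt {p : ℝ} {μ : Measure X} (hp : 1 ≤ p) {V : Set X}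
    {δ : ℝ≥0∞} (hV : sobolevCapacity p μ V < δ) :
    ∃ (v : X → ℝ) (h w : X → ℝ≥0∞), AEMeasurable v μ ∧ (∀ x, 0 ≤ v x) ∧ (∀ x ∈ V, v x = 1) ∧
      IsWeakUpperGradient p μ (fun x => (v x : EReal)) h ∧ ∫⁻ x, h x ^ p ∂μ < δ ∧
      Measurable w ∧ (∀ x, ENNReal.ofReal (v x) ≤ w x) ∧ ∫⁻ x, w x ^ p ∂μ < δ := by
  simp only [sobolevCapacity, iInf_lt_iff, exists_prop] at hV
  obtain ⟨v, ⟨hv, hvV⟩, hlt⟩ := hV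
  obtain ⟨h, hh, hhlt⟩ := exists_weakUpperGradient_lt (lt_of_le_of_lt le_add_self hlt)
  have hmeas : AEMeasurable (fun x => truncUnit (v x)) μ :=
    measurable_truncUnit.comp_aemeasurable hv.1
  obtain ⟨w, hw, hvw, hwe⟩ := exists_measurable_ge_ae_eq hmeas.ennreal_ofReal
  refine ⟨fun x => truncUnit (v x), h, w, hmeas, fun x => truncUnit_nonneg _, ?_,
    hh.truncUnit, hhlt, hw, hvw, ?_⟩
  · intro x hx
    exact truncUnit_of_one_le (hvV x hx).ge
  · refine lt_of_le_of_lt ?_ (lt_of_le_of_lt le_self_add hlt)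
    calc ∫⁻ x, w x ^ p ∂μ = ∫⁻ x, ENNReal.ofReal (truncUnit (v x)) ^ p ∂μ :=
          lintegral_congr_ae (hwe.mono fun x hx => by simp only [hx])
      _ ≤ _ := lintegral_mono fun x => by
          refine ENNReal.rpow_le_rpow ?_ (by linarith)
          have := abs_truncUnit_le (v x)
          rwa [EReal.abs_def, abs_of_nonneg (truncUnit_nonneg _)] at this

/-- Away from points where quasicontinuity fails, a superlevel set of a Newtonian function can be
enlarged to an open set on which a competitor for the variational capacity has energy only
slightly larger than that of the given function. -/
lemma iInf_varCapacity_rpow_le {p : ℝ} (hp : 1 ≤ p) {μ : Measure X}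
    (hqc : ∀ u : X → EReal, MemNewtonian p μ u → QuasicontinuousFun p μ u)
    {A E : Set X} {d : ℝ} (hd : 0 < d) (hAE : ∀ x ∈ A, ∀ y ∉ E, d ≤ dist x y)
    {u : X → EReal} (hu : MemNewtonian0 p μ E u) (huA : ∀ x ∈ A, 1 ≤ u x)
    {g : X → ℝ≥0∞} (hg : IsWeakUpperGradient p μ u g) (hgtop : ∫⁻ x, g x ^ p ∂μ < ⊤)
    {L : ℝ≥0} (hL : L = (d / 2).toNNReal⁻¹) {t : ℝ} (ht : 0 < t) :
    (⨅ (G : Set X) (_ : IsOpen G ∧ A ⊆ G ∧ G ⊆ E), varCapacity p μ G E) ^ (1 / p) ≤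
      ENNReal.ofReal (1 + t) * (∫⁻ x, g x ^ p ∂μ) ^ (1 / p)
        + (1 + L) * ENNReal.ofReal t := by
  have hp0 : 0 < p := by linarith
  have hd2 : 0 < d / 2 := by positivity
  have hc0 : 0 ≤ 1 + t := by linarith
  have htp : 0 < ENNReal.ofReal t ^ p :=
    ENNReal.rpow_pos (ENNReal.ofReal_pos.2 ht) ENNReal.ofReal_ne_top
  have htptop : ENNReal.ofReal t ^ p < ⊤ :=
    ENNReal.rpow_lt_top_of_nonneg hp0.le ENNReal.ofReal_ne_top
  obtain ⟨V, hVo, hVc, -, hcont⟩ := hqc _ (hu.1.truncUnit hp) _ htp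
  obtain ⟨v, h, w, hvm, hv0, hvV, hh, hhlt, hw, hvw, hwlt⟩ :=
    exists_test_of_sobolevCapacity_lt hp hVc
  obtain ⟨U, hUo, hU⟩ := continuousOn_iff'.1 hcont (Ioi (((1 + t)⁻¹ : ℝ) : EReal)) isOpen_Ioi
  set T := thickening (d / 2) A
  set η : X → ℝ := fun x => (thickenedIndicator hd2 T x : ℝ)
  have hη0 : ∀ x, 0 ≤ η x := fun x => NNReal.coe_nonneg _
  have hη1 : ∀ x, η x ≤ 1 := fun x => by exact_mod_cast thickenedIndicator_le_one hd2 T x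
  have hηT : ∀ x ∈ T, η x = 1 := fun x hx =>
    congrArg NNReal.toReal (thickenedIndicator_one hd2 T hx)
  have hthick : thickening d A ⊆ E := by
    intro x hx
    obtain ⟨a, ha, hxa⟩ := mem_thickening_iff.1 hx
    by_contra hxE
    rw [dist_comm] at hxa
    exact absurd (hAE a ha x hxE) (not_le.2 hxa)
  have hηE : ∀ x ∉ E, η x = 0 := by
    intro x hx
    have : x ∉ thickening (d / 2) T := fun hxT => hx (hthick (by
      have := thickening_thickening_subset (d / 2) (d / 2) A hxT
      rwa [add_halves] at this))
    exact congrArg NNReal.toReal (thickenedIndicator_zero hd2 T this)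
  have hηL : LipschitzWith L η := by
    rw [hL]
    exact lipschitzWith_thickenedIndicator hd2 T
  have hηm : Measurable η := hηL.continuous.measurable
  set f : X → ℝ := fun x => max ((1 + t) * truncUnit (u x)) (η x * v x) with hf
  have hwug : IsWeakUpperGradient p μ (fun x => (f x : EReal))
      (fun x => ENNReal.ofReal (1 + t) * g x + (h x + L * w x)) :=
    hg.truncUnit.max_const_mul hp hc0 (hh.lipschitz_mul hv0 hη0 hη1 hηL hw hvw)
  have hMink : (∫⁻ x, (ENNReal.ofReal (1 + t) * g x + (h x + L * w x)) ^ p ∂μ) ^ (1 / p) ≤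
      ENNReal.ofReal (1 + t) * (∫⁻ x, g x ^ p ∂μ) ^ (1 / p) + (1 + L) * ENNReal.ofReal t := by
    have hscale : ∀ (c : ℝ≥0∞) (k : X → ℝ≥0∞), c ≠ ⊤ →
        (∫⁻ x, (c * k x) ^ p ∂μ) ^ (1 / p) = c * (∫⁻ x, k x ^ p ∂μ) ^ (1 / p) := by
      intro c k hc
      simp_rw [ENNReal.mul_rpow_of_nonneg _ _ hp0.le]
      rw [lintegral_const_mul' _ _ (ENNReal.rpow_lt_top_of_nonneg hp0.le hc).ne,
        ENNReal.mul_rpow_of_nonneg _ _ (by positivity), ← ENNReal.rpow_mul,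
        mul_one_div_cancel hp0.ne', ENNReal.rpow_one]
    have hsmall : ∀ k : X → ℝ≥0∞, ∫⁻ x, k x ^ p ∂μ < ENNReal.ofReal t ^ p →
        (∫⁻ x, k x ^ p ∂μ) ^ (1 / p) ≤ ENNReal.ofReal t := by
      intro k hk
      rw [one_div]
      exact (ENNReal.rpow_inv_le_iff hp0).2 hk.le
    refine (ENNReal.lintegral_Lp_add_le (hg.1.const_mul _).aemeasurable
      (hh.1.add (hw.const_mul _)).aemeasurable hp).trans ?_
    rw [hscale _ _ ENNReal.ofReal_ne_top]
    refine add_le_add le_rfl ((ENNReal.lintegral_Lp_add_le hh.1.aemeasurable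
      (hw.const_mul _).aemeasurable hp).trans ?_)
    rw [hscale _ _ ENNReal.coe_ne_top, add_mul, one_mul]
    exact add_le_add (hsmall h hhlt) (mul_le_mul_right (hsmall w hwlt) _)
  refine le_trans (ENNReal.rpow_le_rpow ?_ (by positivity)) hMink
  refine le_trans ?_ (iInf₂_le _ hwug : gradEnergy p μ (fun x => (f x : EReal)) ≤ _)
  have hfE : ∀ x ∉ E, f x = 0 := fun x hx => by
    simp [hf, hηE x hx, hu.2 x hx, truncUnit_zero]
  have hfm : AEMeasurable f μ :=
    ((measurable_truncUnit.comp_aemeasurable hu.1.1).const_mul _).max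
      (hηm.aemeasurable.mul hvm)
  have hfN : MemNewtonian p μ (fun x => (f x : EReal)) := by
    refine ⟨measurable_coe_real_ereal.comp_aemeasurable hfm, ENNReal.add_lt_top.2 ⟨?_, ?_⟩⟩
    · have hk : ∫⁻ x, (ENNReal.ofReal (1 + t) * (u x).abs) ^ p ∂μ < ⊤ := by
        simp_rw [ENNReal.mul_rpow_of_nonneg _ _ hp0.le]
        have hne := ENNReal.rpow_lt_top_of_nonneg hp0.le (ENNReal.ofReal_ne_top (r := 1 + t))
        rw [lintegral_const_mul' _ _ hne.ne]
        exact ENNReal.mul_lt_top hne (lt_of_le_of_lt le_self_add hu.1.2)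
      refine lt_of_le_of_lt (lintegral_mono fun x => ENNReal.rpow_le_rpow ?_ hp0.le)
        (ENNReal.lintegral_rpow_add_lt_top_of_lintegral_rpow_lt_top hw.aemeasurable
          (hwlt.trans htptop) hk hp)
      have h1 : 0 ≤ (1 + t) * truncUnit (u x) := mul_nonneg hc0 (truncUnit_nonneg _)
      have h2 : 0 ≤ η x * v x := mul_nonneg (hη0 x) (hv0 x)
      have h3 : |f x| ≤ v x + (1 + t) * truncUnit (u x) := by
        rw [abs_of_nonneg (h1.trans (le_max_left _ _))]
        refine max_le (by linarith [hv0 x]) ?_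
        linarith [mul_le_of_le_one_left (hv0 x) (hη1 x)]
      rw [EReal.abs_def]
      refine (ENNReal.ofReal_le_ofReal h3).trans ?_
      rw [ENNReal.ofReal_add (hv0 x) h1, ENNReal.ofReal_mul hc0]
      refine add_le_add (hvw x) (mul_le_mul_right ?_ _)
      have := abs_truncUnit_le (u x)
      rwa [EReal.abs_def, abs_of_nonneg (truncUnit_nonneg _)] at this
    · refine lt_of_le_of_lt (iInf₂_le _ hwug) ?_
      rw [← ENNReal.rpow_lt_top_iff_of_pos (y := 1 / p) (by positivity)]
      refine lt_of_le_of_lt hMink (ENNReal.add_lt_top.2 ⟨?_, ?_⟩)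
      · exact ENNReal.mul_lt_top ENNReal.ofReal_lt_top
          (ENNReal.rpow_lt_top_of_nonneg (by positivity) hgtop.ne)
      · exact ENNReal.mul_lt_top (by simp) ENNReal.ofReal_lt_top
  have hmemU : ∀ x ∉ V, (x ∈ U ↔ (1 + t)⁻¹ < truncUnit (u x)) := by
    intro x hx
    have := Set.ext_iff.1 hU x
    simp only [mem_inter_iff, mem_preimage, mem_Ioi, mem_compl_iff, hx, not_false_eq_true,
      and_true, EReal.coe_lt_coe_iff] at this
    exact this.symm
  have hG : IsOpen ((U ∪ V) ∩ T) ∧ A ⊆ (U ∪ V) ∩ T ∧ (U ∪ V) ∩ T ⊆ E := by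
    refine ⟨(hUo.union hVo).inter isOpen_thickening, fun x hx => ⟨?_, ?_⟩, ?_⟩
    · by_cases hxV : x ∈ V
      · exact Or.inr hxV
      · refine Or.inl ((hmemU x hxV).2 ?_)
        rw [truncUnit_of_one_le (huA x hx)]
        exact inv_lt_one_of_one_lt₀ (by linarith)
    · exact self_subset_thickening hd2 A hx
    · exact inter_subset_right.trans ((thickening_mono (by linarith) A).trans hthick)
  have hfG : ∀ x ∈ (U ∪ V) ∩ T, 1 ≤ (f x : EReal) := by
    rintro x ⟨hx, hxT⟩
    have : 1 ≤ f x := by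
      by_cases hxV : x ∈ V
      · refine le_trans ?_ (le_max_right _ _)
        rw [hηT x hxT, hvV x hxV, one_mul]
      · refine le_trans ?_ (le_max_left _ _)
        have hlt := (hmemU x hxV).1 (hx.resolve_right hxV)
        rw [inv_lt_iff_one_lt_mul₀ (by linarith)] at hlt
        linarith
    exact_mod_cast this
  have hf0 : MemNewtonian0 p μ E (fun x => (f x : EReal)) :=
    ⟨hfN, fun x hx => by simp [hfE x hx]⟩
  exact (iInf₂_le ((U ∪ V) ∩ T) hG).trans (iInf₂_le (fun x => (f x : EReal)) ⟨hf0, hfG⟩)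

/-- If all Newtonian functions are quasicontinuous and
`dist(A, X \\ E) > 0`, then `cap_p` is outer at `A` (any `1 ≤ p < ∞`). -/
theorem stmt_12 (p : ℝ) (hp : 1 ≤ p) (μ : Measure X)
    (hball : ∀ (x : X) (r : ℝ), 0 < r → 0 < μ (Metric.ball x r) ∧ μ (Metric.ball x r) < ⊤)
    (hqc : ∀ u : X → EReal, MemNewtonian p μ u → QuasicontinuousFun p μ u)
    (E : Set X) (hE : Bornology.IsBounded E)
    (A : Set X) (hAE : A ⊆ E)
    (hd : ∃ d : ℝ, 0 < d ∧ ∀ x ∈ A, ∀ y ∉ E, d ≤ dist x y) :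
    varCapacity p μ A E =
      ⨅ (G : Set X) (_ : IsOpen G ∧ A ⊆ G ∧ G ⊆ E), varCapacity p μ G E := by
  refine le_antisymm ?_ ?_
  · exact le_iInf₂ fun G hG => le_iInf₂ fun u hu =>
      iInf₂_le u ⟨hu.1, fun x hx => hu.2 x (hG.2.1 hx)⟩
  obtain ⟨d, hd0, hd⟩ := hd
  have hp0 : 0 < p := by linarith
  refine le_iInf₂ fun u hu => le_iInf₂ fun g hg => ?_
  by_cases hgtop : ∫⁻ x, g x ^ p ∂μ = ⊤
  · rw [hgtop]
    exact le_top
  have key := fun t ht => iInf_varCapacity_rpow_le hp hqc hd0 hd hu.1 hu.2 hg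
    (lt_top_iff_ne_top.2 hgtop) rfl (t := t) ht
  have hIp : (∫⁻ x, g x ^ p ∂μ) ^ (1 / p) ≠ ⊤ :=
    (ENNReal.rpow_lt_top_of_nonneg (by positivity) hgtop).ne
  set L := (d / 2).toNNReal⁻¹
  have hlim : Tendsto (fun t : ℝ => ENNReal.ofReal (1 + t) * (∫⁻ x, g x ^ p ∂μ) ^ (1 / p)
      + (1 + L) * ENNReal.ofReal t) (𝓝[>] 0)
      (𝓝 (ENNReal.ofReal (1 + 0) * (∫⁻ x, g x ^ p ∂μ) ^ (1 / p)
        + (1 + L) * ENNReal.ofReal 0)) := by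
    have hid : Tendsto (fun t : ℝ => t) (𝓝[>] 0) (𝓝 0) := nhdsWithin_le_nhds
    refine Tendsto.add ?_ ?_
    · exact ENNReal.Tendsto.mul_const (ENNReal.tendsto_ofReal (tendsto_const_nhds.add hid))
        (Or.inr hIp)
    · exact ENNReal.Tendsto.const_mul (ENNReal.tendsto_ofReal hid) (Or.inr (by simp))
  have h := ge_of_tendsto hlim (eventually_nhdsWithin_of_forall key)
  simp only [add_zero, ENNReal.ofReal_one, one_mul, ENNReal.ofReal_zero, mul_zero] at h
  exact (ENNReal.rpow_le_rpow_iff (by positivity)).1 h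

end
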